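/- arXiv:2203.06057 — 2 statements merged into one kernel-verified Lean document; each statement's English description precedes it below -/
import Mathlib

section
/- Let λ be a Lévy measure on (0,∞) satisfying Condition (E). Suppose that either m_{1+2/d}(λ) = ∫_{(0,∞)} z^{1+2/d} λ(dz) < ∞, or there exist δ > 0, C > 0 and r₀ > 1 such that λ̄(ry)/λ̄(r) ≤ C y^{−δ} for all r, y ≥ r₀. Then η̄₀(r) ≍ η̄(r) as r → ∞, i.e. there exist constants 0 < a ≤ b < ∞ and r₁ > 1 such that a η̄(r) ≤ η̄₀(r) ≤ b η̄(r) for all r ≥ r₁. -/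
open MeasureTheory Real Filter Set
open scoped ENNReal Topology

noncomputable section

/-- The heat kernel on `ℝ^d` with diffusion constant `κ`. -/
def heatKernel (d : ℕ) (κ : ℝ) (s : ℝ) (x : EuclideanSpace ℝ (Fin d)) : ℝ :=
  (2 * π * κ * s) ^ (-(d : ℝ) / 2) * Real.exp (-‖x‖ ^ 2 / (2 * κ * s))

/-- A Lévy measure on `(0,∞)`: a nonzero Borel measure carried by `(0,∞)`
with `∫ min(1, z²) λ(dz) < ∞`. -/
def IsLevyMeasure (lam : Measure ℝ) : Prop :=
  lam ≠ 0 ∧ lam (Set.Iic 0) = 0 ∧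
    ∫⁻ z in Set.Ioi (0 : ℝ), ENNReal.ofReal (min 1 (z ^ 2)) ∂lam < ⊤

/-- `η̄(r) = (Leb ⊗ Leb ⊗ λ)({(s,y,z) ∈ (0,t] × ℝ^d × (0,∞) : g(s,y) z > r})`. -/
def etaBar (d : ℕ) (κ t : ℝ) (lam : Measure ℝ) (r : ℝ) : ℝ≥0∞ :=
  (volume.prod (volume.prod lam))
    {p : ℝ × (EuclideanSpace ℝ (Fin d)) × ℝ |
      p.1 ∈ Set.Ioc (0 : ℝ) t ∧ p.2.2 ∈ Set.Ioi (0 : ℝ) ∧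
        r < heatKernel d κ p.1 p.2.1 * p.2.2}

/-- `η̄₀(r)`, the analogue of `η̄` with the restriction `|y| ≤ 1/2`. -/
def etaBar0 (d : ℕ) (κ t : ℝ) (lam : Measure ℝ) (r : ℝ) : ℝ≥0∞ :=
  (volume.prod (volume.prod lam))
    {p : ℝ × (EuclideanSpace ℝ (Fin d)) × ℝ |
      p.1 ∈ Set.Ioc (0 : ℝ) t ∧ p.2.2 ∈ Set.Ioi (0 : ℝ) ∧ ‖p.2.1‖ ≤ 1 / 2 ∧
        r < heatKernel d κ p.1 p.2.1 * p.2.2}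

/-- `η̄_A(r)`, where the heat kernel is evaluated at `dist(y, A)`. -/
def etaBarA (d : ℕ) (κ t : ℝ) (lam : Measure ℝ)
    (A : Set (EuclideanSpace ℝ (Fin d))) (r : ℝ) : ℝ≥0∞ :=
  (volume.prod (volume.prod lam))
    {p : ℝ × (EuclideanSpace ℝ (Fin d)) × ℝ |
      p.1 ∈ Set.Ioc (0 : ℝ) t ∧ p.2.2 ∈ Set.Ioi (0 : ℝ) ∧
        r < (2 * π * κ * p.1) ^ (-(d : ℝ) / 2) *
            Real.exp (-(Metric.infDist p.2.1 A) ^ 2 / (2 * κ * p.1)) * p.2.2}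

/-- `τ̄(r) = (Leb ⊗ λ)({(s,z) ∈ (0,t] × (0,∞) : (2πκs)^{-d/2} z > r})`. -/
def tauBar (d : ℕ) (κ t : ℝ) (lam : Measure ℝ) (r : ℝ) : ℝ≥0∞ :=
  (volume.prod lam)
    {p : ℝ × ℝ | p.1 ∈ Set.Ioc (0 : ℝ) t ∧ p.2 ∈ Set.Ioi (0 : ℝ) ∧
      r < (2 * π * κ * p.1) ^ (-(d : ℝ) / 2) * p.2}

/-- The truncated moment `M_γ(x) = ∫_{(0,x]} z^γ λ(dz)`. -/
def Mgamma (lam : Measure ℝ) (γ x : ℝ) : ℝ≥0∞ :=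
  ∫⁻ z in Set.Ioc (0 : ℝ) x, ENNReal.ofReal (z ^ γ) ∂lam

/-- A measurable function, positive on `[1,∞)`, is slowly varying at infinity if
`ℓ(cx)/ℓ(x) → 1` as `x → ∞` for every `c > 0`. -/
def SlowlyVarying (ℓ : ℝ → ℝ) : Prop :=
  Measurable ℓ ∧ (∀ x ≥ (1 : ℝ), 0 < ℓ x) ∧
    ∀ c > (0 : ℝ), Tendsto (fun x => ℓ (c * x) / ℓ x) atTop (𝓝 1)

/-- Regular variation at infinity with index `-α`: `f` is eventually positive and
`f(cr)/f(r) → c^{-α}` as `r → ∞` for every `c > 0`. -/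
def RegVaryNeg (f : ℝ → ℝ) (α : ℝ) : Prop :=
  (∀ᶠ r in atTop, 0 < f r) ∧
    ∀ c > (0 : ℝ), Tendsto (fun r => f (c * r) / f r) atTop (𝓝 (c ^ (-α)))

/-- Condition (E): the necessary and sufficient condition for existence of the solution. -/
def ConditionE (d : ℕ) (lam : Measure ℝ) : Prop :=
  (∫⁻ z in Set.Ioi (1 : ℝ), ENNReal.ofReal (Real.log z ^ ((d : ℝ) / 2)) ∂lam < ⊤) ∧
  (d = 1 → ∫⁻ z in Set.Ioc (0 : ℝ) 1, ENNReal.ofReal (z ^ 2) ∂lam < ⊤) ∧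
  (d = 2 → ∫⁻ z in Set.Ioc (0 : ℝ) 1, ENNReal.ofReal (z ^ 2 * |Real.log z|) ∂lam < ⊤) ∧
  (3 ≤ d → ∫⁻ z in Set.Ioc (0 : ℝ) 1, ENNReal.ofReal (z ^ (1 + 2 / (d : ℝ))) ∂lam < ⊤)

/-- Condition (F): `∫_{(0,1)} z^{2/d} λ(dz) < ∞` if `d ≠ 2`,
and `∫_{(0,1)} z |log z| λ(dz) < ∞` if `d = 2`. -/
def ConditionF (d : ℕ) (lam : Measure ℝ) : Prop :=
  (d ≠ 2 → ∫⁻ z in Set.Ioo (0 : ℝ) 1, ENNReal.ofReal (z ^ ((2 : ℝ) / d)) ∂lam < ⊤) ∧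
  (d = 2 → ∫⁻ z in Set.Ioo (0 : ℝ) 1, ENNReal.ofReal (z * |Real.log z|) ∂lam < ⊤)

lemma rpow_le_mul_exp {a x : ℝ} (ha : 0 < a) (hx : 0 ≤ x) :
    x ^ a ≤ a ^ a * Real.exp x := by
  have h1 : x / a ≤ Real.exp (x / a) := by linarith [Real.add_one_le_exp (x / a)]
  calc x ^ a = a ^ a * (x / a) ^ a := by
        rw [← Real.mul_rpow ha.le (by positivity), mul_div_cancel₀ _ ha.ne']
    _ ≤ a ^ a * Real.exp (x / a) ^ a := by gcongr
    _ = a ^ a * Real.exp x := by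
        rw [← Real.exp_mul, div_mul_cancel₀ _ ha.ne']

lemma heatKernel_pos {d : ℕ} {κ s : ℝ} (hκ : 0 < κ) (hs : 0 < s)
    (y : EuclideanSpace ℝ (Fin d)) : 0 < heatKernel d κ s y := by
  unfold heatKernel; positivity

/-- Away from the origin, the heat kernel is bounded uniformly in time. -/
lemma exists_heatKernel_le {d : ℕ} (hd : 1 ≤ d) {κ : ℝ} (hκ : 0 < κ) :
    ∃ B > (0 : ℝ), ∀ s > (0 : ℝ), ∀ y : EuclideanSpace ℝ (Fin d), 1 / 2 < ‖y‖ →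
      heatKernel d κ s y ≤ B := by
  have hd' : (0 : ℝ) < d := by exact_mod_cast hd
  have ha : (0 : ℝ) < (d : ℝ) / 2 := by positivity
  refine ⟨((d : ℝ) / 2) ^ ((d : ℝ) / 2) * (π / 4) ^ (-((d : ℝ) / 2)), by positivity, ?_⟩
  intro s hs y hy
  set x := 1 / (8 * κ * s) with hx
  have hx0 : 0 < x := by positivity
  have h1 : 2 * π * κ * s = (π / 4) * x⁻¹ := by rw [hx]; field_simp; norm_num
  have h2 : -‖y‖ ^ 2 / (2 * κ * s) ≤ -x := by
    rw [hx, neg_div, neg_le_neg_iff, div_le_div_iff₀ (by positivity) (by positivity)]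
    have : (1 / 4 : ℝ) ≤ ‖y‖ ^ 2 := by nlinarith
    nlinarith [mul_pos hκ hs]
  have h3 := rpow_le_mul_exp ha hx0.le
  unfold heatKernel
  rw [h1, neg_div, Real.mul_rpow (by positivity) (by positivity), Real.inv_rpow hx0.le,
    Real.rpow_neg hx0.le, inv_inv]
  calc (π / 4) ^ (-((d : ℝ) / 2)) * x ^ ((d : ℝ) / 2) * Real.exp (-‖y‖ ^ 2 / (2 * κ * s))
      ≤ (π / 4) ^ (-((d : ℝ) / 2)) * (((d : ℝ) / 2) ^ ((d : ℝ) / 2) * Real.exp x) *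
          Real.exp (-x) := by gcongr
    _ = _ := by
        rw [Real.exp_neg]
        field_simp

lemma lintegral_heatKernel_rpow {d : ℕ} {κ s ε : ℝ} (hκ : 0 < κ) (hs : 0 < s) (hε : 0 < ε) :
    ∫⁻ y, ENNReal.ofReal (heatKernel d κ s y ^ ε) =
      ENNReal.ofReal (((2 * π * κ * s) ^ (1 - ε) / ε) ^ ((d : ℝ) / 2)) := by
  set b := ε / (2 * κ * s) with hb
  have hb0 : 0 < b := by positivity
  have key : ∀ y : EuclideanSpace ℝ (Fin d), heatKernel d κ s y ^ ε =
      (2 * π * κ * s) ^ (-(d : ℝ) / 2 * ε) * Real.exp (-b * ‖y‖ ^ 2) := by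
    intro y
    unfold heatKernel
    rw [Real.mul_rpow (by positivity) (by positivity), ← Real.rpow_mul (by positivity),
      ← Real.exp_mul]
    congr 2
    rw [hb]; ring
  have hint := GaussianFourier.integral_rexp_neg_mul_sq_norm
    (V := EuclideanSpace ℝ (Fin d)) hb0
  have hi : Integrable fun y : EuclideanSpace ℝ (Fin d) => Real.exp (-b * ‖y‖ ^ 2) := by
    apply Integrable.of_integral_ne_zero
    rw [hint]
    positivity
  simp_rw [key]
  rw [← ofReal_integral_eq_lintegral_ofReal (hi.const_mul _)
    (Eventually.of_forall fun y => by positivity), integral_const_mul, hint]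
  congr 1
  rw [finrank_euclideanSpace_fin, show -(d : ℝ) / 2 * ε = -ε * ((d : ℝ) / 2) by ring,
    Real.rpow_mul (by positivity), ← Real.mul_rpow (by positivity) (by positivity)]
  congr 1
  rw [Real.rpow_sub (by positivity), Real.rpow_one, Real.rpow_neg (by positivity), hb]
  field_simp

lemma measurable_heatKernel (d : ℕ) (κ : ℝ) :
    Measurable fun p : ℝ × EuclideanSpace ℝ (Fin d) => heatKernel d κ p.1 p.2 := by
  unfold heatKernel; fun_prop

/-- A Chebyshev bound for the jumps of size exceeding `R`. -/
lemma exists_measure_le_lintegral_rpow (d : ℕ) {κ t ε : ℝ} (hκ : 0 < κ)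
    (hε : 0 < ε) (hε1 : ε ≤ 1) (lam : Measure ℝ) [SFinite lam] :
    ∃ K : ℝ≥0∞, K ≠ ∞ ∧ ∀ R > (0 : ℝ), ∀ r > (0 : ℝ),
      (volume.prod (volume.prod lam))
        {p : ℝ × (EuclideanSpace ℝ (Fin d)) × ℝ |
          p.1 ∈ Set.Ioc (0 : ℝ) t ∧ R < p.2.2 ∧ r < heatKernel d κ p.1 p.2.1 * p.2.2} ≤
      K * ∫⁻ z in Set.Ioi R, ENNReal.ofReal ((z / r) ^ ε) ∂lam := by
  refine ⟨ENNReal.ofReal (((2 * π * κ * t) ^ (1 - ε) / ε) ^ ((d : ℝ) / 2)) * ENNReal.ofReal t,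
    ENNReal.mul_ne_top ENNReal.ofReal_ne_top ENNReal.ofReal_ne_top, fun R hR r hr => ?_⟩
  set G : ℝ × (EuclideanSpace ℝ (Fin d)) → ℝ≥0∞ := fun p =>
    (Set.Ioc (0 : ℝ) t).indicator (fun _ => ENNReal.ofReal (heatKernel d κ p.1 p.2 ^ ε)) p.1
    with hG
  set H : ℝ → ℝ≥0∞ := (Set.Ioi R).indicator fun z => ENNReal.ofReal ((z / r) ^ ε) with hH
  have hGm : Measurable G := by
    have h1 := measurable_heatKernel d κ
    have h2 : Measurable fun p : ℝ × EuclideanSpace ℝ (Fin d) =>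
      ENNReal.ofReal (heatKernel d κ p.1 p.2 ^ ε) := by fun_prop
    exact h2.indicator (measurable_fst measurableSet_Ioc)
  have hHm : Measurable H := by
    refine Measurable.indicator ?_ measurableSet_Ioi
    fun_prop
  have hFm : Measurable fun p : ℝ × (EuclideanSpace ℝ (Fin d)) × ℝ =>
      G (p.1, p.2.1) * H p.2.2 := by fun_prop
  calc _ ≤ (volume.prod (volume.prod lam))
        {p : ℝ × (EuclideanSpace ℝ (Fin d)) × ℝ | 1 ≤ G (p.1, p.2.1) * H p.2.2} := by
        refine measure_mono ?_
        rintro ⟨s, y, z⟩ ⟨hs, hz, hg⟩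
        simp only [Set.mem_ofPred_eq] at hs hz hg ⊢
        have hz0 : 0 < z := hR.trans hz
        have hgp := heatKernel_pos hκ hs.1 y
        rw [hG, hH]
        simp only
        rw [Set.indicator_of_mem hs, Set.indicator_of_mem (Set.mem_Ioi.2 hz),
          ← ENNReal.ofReal_mul (by positivity), ← Real.mul_rpow hgp.le (by positivity)]
        rw [ENNReal.one_le_ofReal]
        refine Real.one_le_rpow ?_ hε.le
        rw [← mul_div_assoc, one_le_div hr]
        exact hg.le
    _ ≤ ∫⁻ p, G (p.1, p.2.1) * H p.2.2 ∂(volume.prod (volume.prod lam)) := by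
        simpa using mul_meas_ge_le_lintegral hFm 1
    _ = (∫⁻ s, ∫⁻ y, G (s, y)) * ∫⁻ z, H z ∂lam := by
        rw [lintegral_prod _ hFm.aemeasurable, ← lintegral_mul_const _ (by fun_prop)]
        refine lintegral_congr fun s => ?_
        rw [← lintegral_mul_const _ (by fun_prop), lintegral_prod _ (by fun_prop)]
        refine lintegral_congr fun y => ?_
        exact lintegral_const_mul (G (s, y)) hHm
    _ ≤ _ := by
        rw [hH, lintegral_indicator measurableSet_Ioi]
        gcongr
        calc ∫⁻ s, ∫⁻ y, G (s, y) ≤ ∫⁻ s, (Set.Ioc (0 : ℝ) t).indicator (fun _ =>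
              ENNReal.ofReal (((2 * π * κ * t) ^ (1 - ε) / ε) ^ ((d : ℝ) / 2))) s := by
              refine lintegral_mono fun s => ?_
              by_cases hs : s ∈ Set.Ioc (0 : ℝ) t
              · have hs0 := hs.1
                have hst := hs.2
                simp only [hG, Set.indicator_of_mem hs]
                rw [lintegral_heatKernel_rpow hκ hs.1 hε]
                apply ENNReal.ofReal_le_ofReal
                have : 0 ≤ 1 - ε := by linarith
                gcongr
              · simp [hG, Set.indicator_of_notMem hs]
          _ = _ := by
              rw [lintegral_indicator_const measurableSet_Ioc, Real.volume_Ioc, sub_zero]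

/-- The mass of jumps `z > z₁` hitting near the origin. -/
lemma exists_le_etaBar0 {d : ℕ} (hd : 1 ≤ d) {κ t u₀ : ℝ} (hκ : 0 < κ) (ht : 0 < t)
    (hu₀ : 0 < u₀) (lam : Measure ℝ) [SFinite lam] :
    ∃ c > (0 : ℝ), ∀ z₁ > (0 : ℝ), ∀ r > (0 : ℝ), z₁ / r ≤ u₀ →
      ENNReal.ofReal (c * (z₁ / r) ^ (1 + 2 / (d : ℝ))) * lam (Set.Ioi z₁) ≤
        etaBar0 d κ t lam r := by
  have hd' : (0 : ℝ) < d := by exact_mod_cast hd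
  set η : ℝ := min (min t (1 / 2) / u₀ ^ (2 / (d : ℝ)))
    (Real.exp (-1 / (2 * κ)) ^ (2 / (d : ℝ)) / (2 * π * κ)) with hη
  have hη0 : 0 < η := by positivity
  have hη1 : η * u₀ ^ (2 / (d : ℝ)) ≤ min t (1 / 2) := by
    rw [← le_div_iff₀ (by positivity)]; exact min_le_left _ _
  have hη2 : (2 * π * κ * η) ^ ((d : ℝ) / 2) ≤ Real.exp (-1 / (2 * κ)) := by
    have : 2 * π * κ * η ≤ Real.exp (-1 / (2 * κ)) ^ (2 / (d : ℝ)) := by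
      rw [mul_comm, ← le_div_iff₀ (by positivity)]; exact min_le_right _ _
    calc _ ≤ (Real.exp (-1 / (2 * κ)) ^ (2 / (d : ℝ))) ^ ((d : ℝ) / 2) := by gcongr
      _ = _ := by
        rw [← Real.rpow_mul (by positivity), div_mul_div_cancel₀ (by positivity)]
        norm_num
  set V := (volume (Metric.ball (0 : EuclideanSpace ℝ (Fin d)) 1)) with hV
  have hV0 : V ≠ 0 := (Metric.measure_ball_pos _ _ one_pos).ne'
  have hVt : V ≠ ∞ := measure_ball_lt_top.ne
  have hVpos : 0 < V.toReal := ENNReal.toReal_pos hV0 hVt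
  refine ⟨(η / 2) ^ (1 + (d : ℝ) / 2) * V.toReal, by positivity, ?_⟩
  intro z₁ hz₁ r hr hu
  set u := z₁ / r with hu'
  have hu0 : 0 < u := by positivity
  set a := η * u ^ (2 / (d : ℝ)) with ha
  have ha0 : 0 < a := by positivity
  have ha1 : a ≤ min t (1 / 2) := by
    refine le_trans ?_ hη1
    rw [ha]; gcongr
  have hvol : ENNReal.ofReal ((η / 2) ^ (1 + (d : ℝ) / 2) * V.toReal * u ^ (1 + 2 / (d : ℝ))) *
      lam (Set.Ioi z₁) = (volume.prod (volume.prod lam)) (Set.Ioc (a / 2) a ×ˢ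
        (Metric.closedBall (0 : EuclideanSpace ℝ (Fin d)) (√(a / 2)) ×ˢ Set.Ioi z₁)) := by
    rw [Measure.prod_prod, Measure.prod_prod, Real.volume_Ioc,
      Measure.addHaar_closedBall _ _ (by positivity), finrank_euclideanSpace_fin, ← hV,
      ← mul_assoc, ← mul_assoc, ← ENNReal.ofReal_mul (by linarith)]
    congr 1
    nth_rewrite 2 [← ENNReal.ofReal_toReal hVt]
    rw [← ENNReal.ofReal_mul (by rw [sub_half]; positivity)]
    congr 1
    have e1 : (a - a / 2) * √(a / 2) ^ d = (a / 2) ^ (1 + (d : ℝ) / 2) := by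
      rw [Real.rpow_add (by positivity), Real.rpow_one, Real.sqrt_eq_rpow,
        ← Real.rpow_natCast, ← Real.rpow_mul (by positivity)]
      ring_nf
    have e2 : (a / 2) ^ (1 + (d : ℝ) / 2) =
        (η / 2) ^ (1 + (d : ℝ) / 2) * u ^ (1 + 2 / (d : ℝ)) := by
      rw [ha, show η * u ^ (2 / (d : ℝ)) / 2 = (η / 2) * u ^ (2 / (d : ℝ)) by ring,
        Real.mul_rpow (by positivity) (by positivity), ← Real.rpow_mul hu0.le]
      congr 2
      field_simp
      ring
    rw [e1, e2]; ring
  rw [hvol]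
  refine measure_mono ?_
  rintro ⟨s, y, z⟩ ⟨⟨hs1, hs2⟩, hy, hz⟩
  simp only [Set.mem_Ioi, mem_closedBall_zero_iff, Set.mem_ofPred_eq, Set.mem_Ioc] at *
  have hs0 : 0 < s := by linarith
  have hat : a ≤ t := ha1.trans (min_le_left _ _)
  have hah : a ≤ 1 / 2 := ha1.trans (min_le_right _ _)
  have hy2 : ‖y‖ ^ 2 ≤ a / 2 := by
    have := Real.sq_sqrt (show 0 ≤ a / 2 by positivity)
    nlinarith [norm_nonneg y]
  refine ⟨⟨hs0, by linarith⟩, hz₁.trans hz, ?_, ?_⟩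
  · nlinarith [norm_nonneg y]
  have hexp : Real.exp (-1 / (2 * κ)) ≤ Real.exp (-‖y‖ ^ 2 / (2 * κ * s)) := by
    rw [Real.exp_le_exp, neg_div, neg_div, neg_le_neg_iff,
      div_le_div_iff₀ (by positivity) (by positivity)]
    nlinarith
  have hpow : (2 * π * κ * η) ^ (-(d : ℝ) / 2) * u⁻¹ ≤ (2 * π * κ * s) ^ (-(d : ℝ) / 2) := by
    calc _ = (2 * π * κ * a) ^ (-(d : ℝ) / 2) := by
          rw [ha, ← mul_assoc, Real.mul_rpow (x := 2 * π * κ * η) (by positivity) (by positivity),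
            ← Real.rpow_mul hu0.le, show 2 / (d : ℝ) * (-d / 2) = -1 by field_simp,
            Real.rpow_neg_one]
      _ ≤ _ := by
          apply Real.rpow_le_rpow_of_nonpos (by positivity) (by gcongr)
          rw [neg_div]; linarith [div_pos hd' two_pos]
  have hone : 1 ≤ (2 * π * κ * η) ^ (-(d : ℝ) / 2) * Real.exp (-1 / (2 * κ)) := by
    rw [neg_div (2 : ℝ) (d : ℝ), Real.rpow_neg (by positivity), inv_mul_eq_div,
      one_le_div (by positivity)]
    exact hη2
  have hg : u⁻¹ ≤ heatKernel d κ s y := by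
    unfold heatKernel
    calc u⁻¹ = 1 * u⁻¹ := (one_mul _).symm
      _ ≤ (2 * π * κ * η) ^ (-(d : ℝ) / 2) * Real.exp (-1 / (2 * κ)) * u⁻¹ := by gcongr
      _ = (2 * π * κ * η) ^ (-(d : ℝ) / 2) * u⁻¹ * Real.exp (-1 / (2 * κ)) := by ring
      _ ≤ _ := by gcongr
  calc r = u⁻¹ * z₁ := by rw [hu']; field_simp
    _ < u⁻¹ * z := by gcongr
    _ ≤ _ := by gcongr; exact (hz₁.trans hz).le

lemma IsLevyMeasure.measure_Ioi_lt_top {lam : Measure ℝ} (h : IsLevyMeasure lam) {R : ℝ}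
    (hR : 0 < R) : lam (Set.Ioi R) < ∞ := by
  set m := min 1 (R ^ 2) with hm
  have hm0 : 0 < m := by positivity
  have h1 : ENNReal.ofReal m * lam (Set.Ioi R) ≤
      ∫⁻ z in Set.Ioi (0 : ℝ), ENNReal.ofReal (min 1 (z ^ 2)) ∂lam := by
    calc ENNReal.ofReal m * lam (Set.Ioi R) = ∫⁻ _ in Set.Ioi R, ENNReal.ofReal m ∂lam := by
          rw [setLIntegral_const]
      _ ≤ ∫⁻ z in Set.Ioi R, ENNReal.ofReal (min 1 (z ^ 2)) ∂lam := by
          refine setLIntegral_mono' measurableSet_Ioi fun z hz => ?_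
          have hz' : R < z := hz
          rw [hm]; gcongr
      _ ≤ _ := lintegral_mono_set (Set.Ioi_subset_Ioi hR.le)
  by_contra! hc
  rw [top_le_iff.1 hc, ENNReal.mul_top (by simpa using hm0)] at h1
  exact absurd h.2.2 (not_lt.2 h1)

lemma iUnion_Iic_Ioi_inv :
    ⋃ n : ℕ, (Set.Iic (0 : ℝ) ∪ Set.Ioi (1 / ((n : ℝ) + 1))) = Set.univ := by
  refine Set.eq_univ_of_forall fun x => Set.mem_iUnion.2 ?_
  rcases le_or_gt x 0 with hx | hx
  · exact ⟨0, Or.inl hx⟩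
  · obtain ⟨n, hn⟩ := exists_nat_one_div_lt hx
    exact ⟨n, Or.inr hn⟩

lemma IsLevyMeasure.sigmaFinite {lam : Measure ℝ} (h : IsLevyMeasure lam) : SigmaFinite lam :=
  ⟨⟨{ set := fun n : ℕ => Set.Iic (0 : ℝ) ∪ Set.Ioi (1 / ((n : ℝ) + 1))
      set_mem := fun _ => trivial
      finite := fun n => (measure_union_le _ _).trans_lt (by
        rw [h.2.1, zero_add]
        exact h.measure_Ioi_lt_top (by positivity))
      spanning := iUnion_Iic_Ioi_inv }⟩⟩

lemma IsLevyMeasure.exists_measure_Ioi_ne_zero {lam : Measure ℝ} (h : IsLevyMeasure lam) :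
    ∃ z > (0 : ℝ), lam (Set.Ioi z) ≠ 0 := by
  by_contra! hc
  apply h.1
  rw [← Measure.measure_univ_eq_zero, ← iUnion_Iic_Ioi_inv, measure_iUnion_null_iff]
  intro n
  rw [measure_union_null_iff]
  exact ⟨h.2.1, hc _ (by positivity)⟩

/-- A power-type tail bound on `λ` controls the partial moments of order smaller than the tail
exponent. -/
lemma IsLevyMeasure.lintegral_rpow_le_of_tail {lam : Measure ℝ} (h : IsLevyMeasure lam)
    {δ C r₀ ε : ℝ} (hC : 0 < C) (hr₀ : 1 < r₀) (hε : 0 < ε) (hεδ : ε < δ)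
    (htail : ∀ r ≥ r₀, ∀ y ≥ r₀,
      (lam (Set.Ioi (r * y))).toReal / (lam (Set.Ioi r)).toReal ≤ C * y ^ (-δ)) :
    ∃ K : ℝ≥0∞, K ≠ ∞ ∧ ∀ R ≥ r₀,
      ∫⁻ z in Set.Ioi R, ENNReal.ofReal ((z / R) ^ ε) ∂lam ≤ K * lam (Set.Ioi R) := by
  have hr0 : 0 < r₀ := by linarith
  set C' := max C 1 with hC'
  have hC'0 : 0 < C' := by positivity
  have htail' : ∀ R ≥ r₀, ∀ k : ℕ, lam (Set.Ioi (R * r₀ ^ k)) ≤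
      ENNReal.ofReal (C' * (r₀ ^ k) ^ (-δ)) * lam (Set.Ioi R) := by
    intro R hR k
    have hR0 : 0 < R := by linarith
    rcases Nat.eq_zero_or_pos k with rfl | hk
    · simp only [pow_zero, mul_one, Real.one_rpow]
      exact le_mul_of_one_le_left' (ENNReal.one_le_ofReal.2 (le_max_right _ _))
    have hf := (h.measure_Ioi_lt_top hR0).ne
    have hle : lam (Set.Ioi (R * r₀ ^ k)) ≤ lam (Set.Ioi R) :=
      measure_mono (Set.Ioi_subset_Ioi (le_mul_of_one_le_right hR0.le (one_le_pow₀ hr₀.le)))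
    rcases eq_or_ne (lam (Set.Ioi R)) 0 with h0 | h0
    · rw [h0] at hle ⊢; simpa using hle
    have h1 := htail R hR (r₀ ^ k) (le_self_pow₀ hr₀.le hk.ne')
    rw [div_le_iff₀ (ENNReal.toReal_pos h0 hf)] at h1
    rw [← ENNReal.ofReal_toReal (hle.trans_lt hf.lt_top).ne,
      ← ENNReal.ofReal_toReal hf, ← ENNReal.ofReal_mul (by positivity)]
    apply ENNReal.ofReal_le_ofReal
    refine h1.trans ?_
    gcongr
    exact le_max_left _ _
  set q := r₀ ^ (ε - δ) with hq
  have hq0 : 0 < q := by positivity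
  have hq1 : q < 1 := Real.rpow_lt_one_of_one_lt_of_neg hr₀ (by linarith)
  refine ⟨∑' k : ℕ, ENNReal.ofReal (C' * (r₀ ^ 2) ^ ε * q ^ k), ?_, ?_⟩
  · rw [← ENNReal.ofReal_tsum_of_nonneg (fun k => by positivity)
      ((summable_geometric_of_lt_one hq0.le hq1).mul_left _)]
    exact ENNReal.ofReal_ne_top
  intro R hR
  have hR0 : 0 < R := by linarith
  calc ∫⁻ z in Set.Ioi R, ENNReal.ofReal ((z / R) ^ ε) ∂lam
      ≤ ∫⁻ z in Set.Ioi R, ∑' k : ℕ, (Set.Ioi (R * r₀ ^ k)).indicator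
          (fun _ => ENNReal.ofReal ((r₀ ^ (k + 2)) ^ ε)) z ∂lam := by
        refine setLIntegral_mono' measurableSet_Ioi fun z hz => ?_
        have hz' : R < z := hz
        have hx : 1 ≤ z / R := by rw [one_le_div hR0]; exact hz'.le
        obtain ⟨n, hn1, hn2⟩ := exists_nat_pow_near hx hr₀
        refine le_trans ?_ (ENNReal.le_tsum (n - 1))
        have hmem : z ∈ Set.Ioi (R * r₀ ^ (n - 1)) := by
          rcases Nat.eq_zero_or_pos n with rfl | hpos
          · simpa using hz'
          · have : r₀ ^ (n - 1) < z / R :=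
              (pow_lt_pow_right₀ hr₀ (by omega)).trans_le hn1
            rw [lt_div_iff₀ hR0] at this
            rw [Set.mem_Ioi, mul_comm]; exact this
        rw [Set.indicator_of_mem hmem]
        apply ENNReal.ofReal_le_ofReal
        have : z / R ≤ r₀ ^ (n - 1 + 2) :=
          hn2.le.trans (pow_le_pow_right₀ hr₀.le (by omega))
        gcongr
    _ ≤ ∫⁻ z, ∑' k : ℕ, (Set.Ioi (R * r₀ ^ k)).indicator
          (fun _ => ENNReal.ofReal ((r₀ ^ (k + 2)) ^ ε)) z ∂lam := setLIntegral_le_lintegral _ _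
    _ = ∑' k : ℕ, ENNReal.ofReal ((r₀ ^ (k + 2)) ^ ε) * lam (Set.Ioi (R * r₀ ^ k)) := by
        rw [lintegral_tsum fun k =>
          (measurable_const.indicator measurableSet_Ioi).aemeasurable]
        congr 1 with k
        rw [lintegral_indicator_const measurableSet_Ioi]
    _ ≤ ∑' k : ℕ, ENNReal.ofReal (C' * (r₀ ^ 2) ^ ε * q ^ k) * lam (Set.Ioi R) := by
        refine ENNReal.tsum_le_tsum fun k => ?_
        calc _ ≤ ENNReal.ofReal ((r₀ ^ (k + 2)) ^ ε) *
              (ENNReal.ofReal (C' * (r₀ ^ k) ^ (-δ)) * lam (Set.Ioi R)) := by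
              gcongr; exact htail' R hR k
          _ = _ := by
              rw [← mul_assoc, ← ENNReal.ofReal_mul (by positivity)]
              congr 2
              have : q ^ k = (r₀ ^ k) ^ ε * (r₀ ^ k) ^ (-δ) := by
                rw [← Real.rpow_add (by positivity), ← sub_eq_add_neg, hq,
                  ← Real.rpow_natCast, ← Real.rpow_natCast, ← Real.rpow_mul hr0.le,
                  ← Real.rpow_mul hr0.le, mul_comm]
              rw [this, pow_add, Real.mul_rpow (by positivity) (by positivity)]
              ring
    _ = _ := ENNReal.tsum_mul_right

/-- The jumps exceeding `u₀ r` contribute at most a constant multiple of `η̄₀(r)`. -/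
lemma exists_measure_large_le_etaBar0 {d : ℕ} (hd : 1 ≤ d) {κ t u₀ : ℝ} (hκ : 0 < κ)
    (ht : 0 < t) (hu₀ : 0 < u₀) {lam : Measure ℝ} (hlam : IsLevyMeasure lam)
    (halt : (∫⁻ z in Set.Ioi (0 : ℝ),
        ENNReal.ofReal (z ^ (1 + 2 / (d : ℝ))) ∂lam < ⊤) ∨
      (∃ δ > (0 : ℝ), ∃ C > (0 : ℝ), ∃ r₀ > (1 : ℝ), ∀ r ≥ r₀, ∀ y ≥ r₀,
        (lam (Set.Ioi (r * y))).toReal / (lam (Set.Ioi r)).toReal ≤ C * y ^ (-δ))) :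
    ∃ K : ℝ≥0∞, K ≠ ∞ ∧ ∃ r₁ > (1 : ℝ), ∀ r ≥ r₁,
      (volume.prod (volume.prod lam))
        {p : ℝ × (EuclideanSpace ℝ (Fin d)) × ℝ |
          p.1 ∈ Set.Ioc (0 : ℝ) t ∧ u₀ * r < p.2.2 ∧
            r < heatKernel d κ p.1 p.2.1 * p.2.2} ≤ K * etaBar0 d κ t lam r := by
  have := hlam.sigmaFinite
  have hd' : (0 : ℝ) < d := by exact_mod_cast hd
  set p : ℝ := 1 + 2 / (d : ℝ) with hp
  have hp1 : 0 < p - 1 := by rw [hp, add_sub_cancel_left]; positivity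
  have hp0 : 0 < p := by linarith
  obtain ⟨c, hc, hlow⟩ := exists_le_etaBar0 hd hκ ht hu₀ lam
  rcases halt with hm | ⟨δ, hδ, C, hC, r₀, hr₀, htail⟩
  · set m := ∫⁻ z in Set.Ioi (0 : ℝ), ENNReal.ofReal (z ^ p) ∂lam with hm_def
    obtain ⟨K, hK, hup⟩ := exists_measure_le_lintegral_rpow d hκ one_pos le_rfl lam
    obtain ⟨z₁, hz₁, hne⟩ := hlam.exists_measure_Ioi_ne_zero
    set w := ENNReal.ofReal (c * z₁ ^ p) * lam (Set.Ioi z₁) with hw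
    have hw0 : w ≠ 0 :=
      mul_ne_zero (by simp only [ne_eq, ENNReal.ofReal_eq_zero, not_le]; positivity) hne
    have hwt : w ≠ ∞ := ENNReal.mul_ne_top ENNReal.ofReal_ne_top (hlam.measure_Ioi_lt_top hz₁).ne
    set A := ENNReal.ofReal ((u₀ ^ (p - 1))⁻¹) with hA
    refine ⟨K * (A * m) * w⁻¹, ?_, max 2 (z₁ / u₀), lt_max_of_lt_left one_lt_two,
      fun r hr => ?_⟩
    · exact ENNReal.mul_ne_top (ENNReal.mul_ne_top hK (ENNReal.mul_ne_top ENNReal.ofReal_ne_top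
        hm.ne)) (ENNReal.inv_ne_top.2 hw0)
    have hr0 : 0 < r := by linarith [le_max_left 2 (z₁ / u₀)]
    have hr1 : z₁ / r ≤ u₀ := by
      rw [div_le_iff₀ hr0, mul_comm, ← div_le_iff₀ hu₀]
      exact (le_max_right _ _).trans hr
    set ρ := ENNReal.ofReal ((r ^ p)⁻¹) with hρ
    have hl : ρ * w ≤ etaBar0 d κ t lam r := by
      refine le_trans (le_of_eq ?_) (hlow z₁ hz₁ r hr0 hr1)
      rw [hw, ← mul_assoc, ← ENNReal.ofReal_mul (by positivity),
        Real.div_rpow hz₁.le hr0.le]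
      congr 2
      ring
    have hi : ∫⁻ z in Set.Ioi (u₀ * r), ENNReal.ofReal ((z / r) ^ (1 : ℝ)) ∂lam ≤
        A * m * ρ := by
      calc _ ≤ ∫⁻ z in Set.Ioi (u₀ * r), A * ρ * ENNReal.ofReal (z ^ p) ∂lam := by
            refine setLIntegral_mono' measurableSet_Ioi fun z hz => ?_
            have hz' : u₀ * r < z := hz
            have hz0 : 0 < z := (mul_pos hu₀ hr0).trans hz'
            rw [hA, hρ, ← ENNReal.ofReal_mul (by positivity), ← ENNReal.ofReal_mul (by positivity)]
            apply ENNReal.ofReal_le_ofReal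
            have h1 : u₀ ≤ z / r := by rw [le_div_iff₀ hr0]; exact hz'.le
            have h2 : u₀ ^ (p - 1) ≤ (z / r) ^ (p - 1) := by gcongr
            have h3 : (z / r) ^ p = (z / r) * (z / r) ^ (p - 1) := by
              nth_rewrite 2 [← Real.rpow_one (z / r)]
              rw [← Real.rpow_add (by positivity), add_sub_cancel]
            have h4 : (u₀ ^ (p - 1))⁻¹ * (r ^ p)⁻¹ * z ^ p =
                (z / r) * (z / r) ^ (p - 1) / u₀ ^ (p - 1) := by
              rw [← h3, Real.div_rpow hz0.le hr0.le]; field_simp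
            rw [h4, Real.rpow_one, le_div_iff₀ (by positivity)]
            gcongr
        _ ≤ ∫⁻ z in Set.Ioi 0, A * ρ * ENNReal.ofReal (z ^ p) ∂lam :=
            lintegral_mono_set (Set.Ioi_subset_Ioi (by positivity))
        _ = _ := by
            rw [lintegral_const_mul _ (by fun_prop), ← hm_def]
            ring
    calc _ ≤ K * (A * m * ρ) := (hup _ (by positivity) r hr0).trans (by gcongr)
      _ = K * (A * m) * w⁻¹ * (ρ * w) := by
          rw [show K * (A * m) * w⁻¹ * (ρ * w) = K * (A * m * ρ) * (w⁻¹ * w) by ring,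
            ENNReal.inv_mul_cancel hw0 hwt, mul_one]
      _ ≤ _ := by gcongr
  · set ε := min (δ / 2) 1 with hε
    have hε0 : 0 < ε := by positivity
    have hεδ : ε < δ := (min_le_left _ _).trans_lt (by linarith)
    obtain ⟨K, hK, hup⟩ := exists_measure_le_lintegral_rpow d hκ hε0 (min_le_right _ _) lam
    obtain ⟨L, hL, htl⟩ := hlam.lintegral_rpow_le_of_tail hC hr₀ hε0 hεδ htail
    set A := ENNReal.ofReal (u₀ ^ ε) with hA
    set w := ENNReal.ofReal (c * u₀ ^ p) with hw
    have hw0 : w ≠ 0 := by simp only [hw, ne_eq, ENNReal.ofReal_eq_zero, not_le]; positivity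
    have hwt : w ≠ ∞ := ENNReal.ofReal_ne_top
    refine ⟨K * (A * L) * w⁻¹, ?_, max 2 (r₀ / u₀), lt_max_of_lt_left one_lt_two,
      fun r hr => ?_⟩
    · exact ENNReal.mul_ne_top (ENNReal.mul_ne_top hK (ENNReal.mul_ne_top ENNReal.ofReal_ne_top
        hL)) (ENNReal.inv_ne_top.2 hw0)
    have hr0 : 0 < r := by linarith [le_max_left 2 (r₀ / u₀)]
    have hR : r₀ ≤ u₀ * r := by
      rw [mul_comm, ← div_le_iff₀ hu₀]
      exact (le_max_right _ _).trans hr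
    have hR0 : 0 < u₀ * r := by positivity
    have hl : w * lam (Set.Ioi (u₀ * r)) ≤ etaBar0 d κ t lam r := by
      have := hlow (u₀ * r) hR0 r hr0 (mul_div_cancel_right₀ _ hr0.ne').le
      rwa [mul_div_cancel_right₀ _ hr0.ne'] at this
    have hi : ∫⁻ z in Set.Ioi (u₀ * r), ENNReal.ofReal ((z / r) ^ ε) ∂lam ≤
        A * (L * lam (Set.Ioi (u₀ * r))) := by
      calc _ = ∫⁻ z in Set.Ioi (u₀ * r), A * ENNReal.ofReal ((z / (u₀ * r)) ^ ε) ∂lam := by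
            refine setLIntegral_congr_fun measurableSet_Ioi fun z hz => ?_
            have hz' : u₀ * r < z := hz
            have hz0 : 0 < z := hR0.trans hz'
            rw [hA, ← ENNReal.ofReal_mul (by positivity),
              ← Real.mul_rpow hu₀.le (by positivity)]
            congr 2
            field_simp
        _ = A * ∫⁻ z in Set.Ioi (u₀ * r), ENNReal.ofReal ((z / (u₀ * r)) ^ ε) ∂lam :=
            lintegral_const_mul _ (by fun_prop)
        _ ≤ _ := by gcongr; exact htl _ hR
    calc _ ≤ K * (A * (L * lam (Set.Ioi (u₀ * r)))) :=
          (hup _ hR0 r hr0).trans (by gcongr)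
      _ = K * (A * L) * w⁻¹ * (w * lam (Set.Ioi (u₀ * r))) := by
          rw [show K * (A * L) * w⁻¹ * (w * lam (Set.Ioi (u₀ * r))) =
            K * (A * (L * lam (Set.Ioi (u₀ * r)))) * (w⁻¹ * w) by ring,
            ENNReal.inv_mul_cancel hw0 hwt, mul_one]
      _ ≤ _ := by gcongr

/-- Lemma 4.3 (i): under Condition (E), if `m_{1+2/d}(λ) < ∞` or
`λ̄(ry)/λ̄(r) ≤ C y^{-δ}` for all `r, y ≥ r₀`, then `η̄₀(r) ≍ η̄(r)` as `r → ∞`. -/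
theorem stmt_17 (d : ℕ) (hd : 1 ≤ d) (κ t : ℝ) (hκ : 0 < κ) (ht : 0 < t)
    (lam : Measure ℝ) (hlam : IsLevyMeasure lam) (hE : ConditionE d lam)
    (halt : (∫⁻ z in Set.Ioi (0 : ℝ),
        ENNReal.ofReal (z ^ (1 + 2 / (d : ℝ))) ∂lam < ⊤) ∨
      (∃ δ > (0 : ℝ), ∃ C > (0 : ℝ), ∃ r₀ > (1 : ℝ), ∀ r ≥ r₀, ∀ y ≥ r₀,
        (lam (Set.Ioi (r * y))).toReal / (lam (Set.Ioi r)).toReal ≤ C * y ^ (-δ))) :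
    ∃ a b r₁ : ℝ, 0 < a ∧ a ≤ b ∧ 1 < r₁ ∧ ∀ r ≥ r₁,
      ENNReal.ofReal a * etaBar d κ t lam r ≤ etaBar0 d κ t lam r ∧
      etaBar0 d κ t lam r ≤ ENNReal.ofReal b * etaBar d κ t lam r := by
  obtain ⟨B, hB, hg⟩ := exists_heatKernel_le hd hκ
  obtain ⟨K, hK, r₁, hr₁, hlarge⟩ := exists_measure_large_le_etaBar0 hd hκ ht
    (inv_pos.2 hB) hlam halt
  have ha0 : 0 < (1 + K.toReal)⁻¹ := by positivity
  refine ⟨(1 + K.toReal)⁻¹, 1, r₁, ha0, inv_le_one_of_one_le₀ (by simp), hr₁,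
    fun r hr => ⟨?_, ?_⟩⟩
  · have hle : etaBar d κ t lam r ≤ ENNReal.ofReal (1 + K.toReal) * etaBar0 d κ t lam r := by
      calc etaBar d κ t lam r ≤ etaBar0 d κ t lam r + K * etaBar0 d κ t lam r := by
            refine le_trans ?_ (add_le_add_right (hlarge r hr) _)
            refine le_trans (measure_mono ?_) (measure_union_le _ _)
            rintro ⟨s, y, z⟩ ⟨hs, hz, hrz⟩
            simp only [Set.mem_Ioi] at hs hz hrz
            rcases le_or_gt ‖y‖ (1 / 2) with hy | hy
            · exact Or.inl ⟨hs, hz, hy, hrz⟩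
            · refine Or.inr ⟨hs, ?_, hrz⟩
              have h1 : r < B * z := hrz.trans_le (by gcongr; exact hg s hs.1 y hy)
              simpa [inv_mul_lt_iff₀ hB] using h1
        _ = _ := by
            rw [ENNReal.ofReal_add zero_le_one ENNReal.toReal_nonneg, ENNReal.ofReal_one,
              ENNReal.ofReal_toReal hK, add_mul, one_mul]
    calc _ ≤ ENNReal.ofReal (1 + K.toReal)⁻¹ *
          (ENNReal.ofReal (1 + K.toReal) * etaBar0 d κ t lam r) := by gcongr
      _ = etaBar0 d κ t lam r := by
          rw [← mul_assoc, ← ENNReal.ofReal_mul ha0.le, inv_mul_cancel₀ (by positivity),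
            ENNReal.ofReal_one, one_mul]
  · rw [ENNReal.ofReal_one, one_mul]
    refine measure_mono ?_
    rintro ⟨s, y, z⟩ ⟨hs, hz, -, hrz⟩
    exact ⟨hs, hz, hrz⟩
end
end

section
/- There exist finite constants c₁, c₂, C₁, C₂ > 0, depending only on d, t and κ, such that for every Lévy measure λ on (0,∞) and every r > 1: c₁ r^{−1−2/d} M_{1+2/d}(c₂ r) + c₁ λ̄(c₂ r) ≤ η̄₀(r) ≤ C₁ r^{−1−2/d} M_{1+2/d}(C₂ r) + C₁ λ̄(C₂ r), as an inequality in [0,∞]. -/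
open MeasureTheory Real Filter Set
open scoped ENNReal Topology

noncomputable section

lemma heatKernel_mul_rpow {d : ℕ} {κ s σ : ℝ} (hκ : 0 < κ) (hs : 0 < s) (hσ : 0 < σ)
    (y : EuclideanSpace ℝ (Fin d)) :
    heatKernel d κ s y * (2 * π * κ * σ) ^ ((d : ℝ) / 2) =
      Real.exp (d / 2 * Real.log (σ / s) - ‖y‖ ^ 2 / (2 * κ * s)) := by
  have h : (2 * π * κ * s) ^ (-(d : ℝ) / 2) * (2 * π * κ * σ) ^ ((d : ℝ) / 2) =
      Real.exp (d / 2 * Real.log (σ / s)) := by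
    rw [neg_div, Real.rpow_neg (by positivity), inv_mul_eq_div,
      ← Real.div_rpow (by positivity) (by positivity), mul_div_mul_left _ _ (by positivity),
      Real.rpow_def_of_pos (by positivity), mul_comm]
  rw [heatKernel, mul_right_comm, h, ← Real.exp_add]
  congr 1
  ring

lemma one_lt_heatKernel_mul_rpow {d : ℕ} (hd : 1 ≤ d) {κ s σ : ℝ} (hκ : 0 < κ) (hσ : 0 < σ)
    (hs₁ : σ / 4 ≤ s) (hs₂ : s ≤ σ / 2) {y : EuclideanSpace ℝ (Fin d)}
    (hy : ‖y‖ ^ 2 ≤ κ * d / 8 * σ) :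
    1 < heatKernel d κ s y * (2 * π * κ * σ) ^ ((d : ℝ) / 2) := by
  have hs : 0 < s := by linarith
  have hd' : (0 : ℝ) < d := by exact_mod_cast hd
  rw [heatKernel_mul_rpow hκ hs hσ, Real.one_lt_exp_iff, sub_pos]
  have h₁ : ‖y‖ ^ 2 / (2 * κ * s) ≤ d / 4 := by
    rw [div_le_iff₀ (by positivity)]
    nlinarith [mul_le_mul_of_nonneg_left hs₁ (mul_pos hκ hd').le]
  have h₂ : Real.log 2 ≤ Real.log (σ / s) :=
    Real.log_le_log two_pos (by rw [le_div_iff₀ hs]; linarith)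
  nlinarith [Real.log_two_gt_d9]

lemma bounds_of_one_lt_heatKernel_mul_rpow {d : ℕ} (hd : 1 ≤ d) {κ s σ : ℝ} (hκ : 0 < κ)
    (hs : 0 < s) (hσ : 0 < σ) {y : EuclideanSpace ℝ (Fin d)}
    (h : 1 < heatKernel d κ s y * (2 * π * κ * σ) ^ ((d : ℝ) / 2)) :
    s ≤ σ ∧ ‖y‖ ^ 2 ≤ κ * d * σ := by
  have hd' : (0 : ℝ) < d := by exact_mod_cast hd
  rw [heatKernel_mul_rpow hκ hs hσ, Real.one_lt_exp_iff, sub_pos] at h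
  have hlog : 0 < Real.log (σ / s) := by
    have : 0 < (d : ℝ) / 2 * Real.log (σ / s) := lt_of_le_of_lt (by positivity) h
    exact pos_of_mul_pos_right this (by positivity)
  have hsσ : s ≤ σ := by
    by_contra! hlt
    exact hlog.not_ge (Real.log_nonpos (by positivity) ((div_le_one hs).2 hlt.le))
  refine ⟨hsσ, ?_⟩
  rw [div_lt_iff₀ (by positivity)] at h
  have hle : Real.log (σ / s) * s ≤ σ := by
    have := mul_le_mul_of_nonneg_right (Real.log_le_sub_one_of_pos (div_pos hσ hs)) hs.le
    rw [sub_mul, div_mul_cancel₀ _ hs.ne'] at this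
    linarith
  have := mul_le_mul_of_nonneg_left hle (mul_pos hκ hd').le
  linarith

/-- The section at height `z` of the set measured by `etaBar0`. -/
def heatSection (d : ℕ) (κ t r z : ℝ) : Set (ℝ × EuclideanSpace ℝ (Fin d)) :=
  {q | q.1 ∈ Set.Ioc (0 : ℝ) t ∧ z ∈ Set.Ioi (0 : ℝ) ∧ ‖q.2‖ ≤ 1 / 2 ∧
    r < heatKernel d κ q.1 q.2 * z}

lemma IsLevyMeasure.sFinite {lam : Measure ℝ} (h : IsLevyMeasure lam) : SFinite lam := by
  obtain ⟨-, h₀, hfin⟩ := h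
  have hpos : ∀ᵐ z ∂lam.restrict (Set.Ioi 0), ENNReal.ofReal (min 1 (z ^ 2)) ≠ 0 := by
    filter_upwards [ae_restrict_mem measurableSet_Ioi] with z hz
    have : (0 : ℝ) < z := hz
    exact (ENNReal.ofReal_pos.2 (by positivity)).ne'
  have := isFiniteMeasure_withDensity hfin.ne
  rw [← Measure.restrict_eq_self_of_ae_mem (μ := lam) (s := Set.Ioi 0)
    (by simpa [ae_iff, Set.Iic] using h₀),
    ← withDensity_inv_same (by fun_prop) hpos (ae_of_all _ fun _ => ENNReal.ofReal_ne_top)]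
  infer_instance

lemma etaBar0_eq_lintegral {d : ℕ} {κ t : ℝ} {lam : Measure ℝ} (h : IsLevyMeasure lam) (r : ℝ) :
    etaBar0 d κ t lam r =
      ∫⁻ z in Set.Ioi 0, (volume.prod volume) (heatSection d κ t r z) ∂lam := by
  have := h.sFinite
  have hg : Measurable fun p : ℝ × EuclideanSpace ℝ (Fin d) × ℝ =>
      heatKernel d κ p.1 p.2.1 * p.2.2 := by
    unfold heatKernel
    fun_prop
  have hS : MeasurableSet {p : ℝ × (EuclideanSpace ℝ (Fin d)) × ℝ |
      p.1 ∈ Set.Ioc (0 : ℝ) t ∧ p.2.2 ∈ Set.Ioi (0 : ℝ) ∧ ‖p.2.1‖ ≤ 1 / 2 ∧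
        r < heatKernel d κ p.1 p.2.1 * p.2.2} :=
    (measurable_fst measurableSet_Ioc).inter <|
      (measurable_snd.snd measurableSet_Ioi).inter <|
      (measurableSet_le measurable_snd.fst.norm measurable_const).inter <|
      measurableSet_lt measurable_const hg
  rw [Measure.restrict_eq_self_of_ae_mem (by simpa [ae_iff, Set.Iic] using h.2.1), etaBar0,
    ← (measurePreserving_prodAssoc volume volume lam).measure_preimage hS.nullMeasurableSet,
    Measure.prod_apply_symm (MeasurableEquiv.prodAssoc.measurable hS)]
  rfl

lemma volume_prod_closedBall {d : ℕ} {a b κ A : ℝ} (ha : 0 ≤ a) (hb : 0 ≤ b) (hκ : 0 < κ)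
    (hd : 1 ≤ d) (hA : 0 < A) {I : Set ℝ}
    (hI : volume I = ENNReal.ofReal (a * (A ^ (2 / (d : ℝ)) / (2 * π * κ)))) :
    (volume.prod volume) (I ×ˢ Metric.closedBall (0 : EuclideanSpace ℝ (Fin d))
        √(b * (A ^ (2 / (d : ℝ)) / (2 * π * κ)))) =
      ENNReal.ofReal (a * b ^ ((d : ℝ) / 2) / (2 * π * κ) ^ (1 + (d : ℝ) / 2) *
        (volume (Metric.ball (0 : EuclideanSpace ℝ (Fin d)) 1)).toReal * A ^ (1 + 2 / (d : ℝ))) := by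
  have hd' : (d : ℝ) ≠ 0 := by positivity
  have hω : volume (Metric.ball (0 : EuclideanSpace ℝ (Fin d)) 1) ≠ ⊤ := measure_ball_lt_top.ne
  rw [Measure.prod_prod, hI, Measure.addHaar_closedBall _ _ (Real.sqrt_nonneg _),
    ← ENNReal.ofReal_toReal hω, finrank_euclideanSpace_fin, ← ENNReal.ofReal_mul (by positivity),
    ← ENNReal.ofReal_mul (by positivity), ENNReal.toReal_ofReal ENNReal.toReal_nonneg,
    Real.sqrt_eq_rpow, ← Real.rpow_natCast, ← Real.rpow_mul (by positivity),
    Real.mul_rpow hb (by positivity), Real.div_rpow (by positivity) (by positivity),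
    ← Real.rpow_mul hA.le, Real.rpow_add (by positivity), Real.rpow_add hA, Real.rpow_one,
    Real.rpow_one, show (1 : ℝ) / 2 * d = d / 2 by ring,
    show 2 / (d : ℝ) * (d / 2) = 1 by field_simp, Real.rpow_one]
  congr 1
  field_simp

lemma rpow_two_div_scale {d : ℕ} {κ A : ℝ} (hκ : 0 < κ) (hd : 1 ≤ d) (hA : 0 < A) :
    (2 * π * κ * (A ^ (2 / (d : ℝ)) / (2 * π * κ))) ^ ((d : ℝ) / 2) = A := by
  rw [mul_div_cancel₀ _ (by positivity), ← Real.rpow_mul hA.le,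
    show 2 / (d : ℝ) * (d / 2) = 1 by field_simp, Real.rpow_one]

lemma volume_heatSection_le_rpow {d : ℕ} (hd : 1 ≤ d) {κ t r z : ℝ} (hκ : 0 < κ) (hr : 0 < r)
    (hz : 0 < z) :
    (volume.prod volume) (heatSection d κ t r z) ≤
      ENNReal.ofReal (1 * (κ * d) ^ ((d : ℝ) / 2) / (2 * π * κ) ^ (1 + (d : ℝ) / 2) *
        (volume (Metric.ball (0 : EuclideanSpace ℝ (Fin d)) 1)).toReal *
          (z / r) ^ (1 + 2 / (d : ℝ))) := by
  have hA : 0 < z / r := div_pos hz hr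
  rw [← volume_prod_closedBall zero_le_one (by positivity) hκ hd hA
    (I := Set.Ioc 0 ((z / r) ^ (2 / (d : ℝ)) / (2 * π * κ))) (by simp)]
  refine measure_mono ?_
  rintro ⟨s, y⟩ ⟨⟨hs, -⟩, -, -, h⟩
  have h' : 1 < heatKernel d κ s y *
      (2 * π * κ * ((z / r) ^ (2 / (d : ℝ)) / (2 * π * κ))) ^ ((d : ℝ) / 2) := by
    rw [rpow_two_div_scale hκ hd hA, ← mul_div_assoc, one_lt_div hr]
    exact h
  have hb := bounds_of_one_lt_heatKernel_mul_rpow hd hκ hs (by positivity) h'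
  exact ⟨⟨hs, hb.1⟩, by simpa using Real.le_sqrt_of_sq_le hb.2⟩

lemma volume_heatSection_le {d : ℕ} {κ t r z : ℝ} :
    (volume.prod volume) (heatSection d κ t r z) ≤
      ENNReal.ofReal t * volume (Metric.closedBall (0 : EuclideanSpace ℝ (Fin d)) (1 / 2)) := by
  calc _ ≤ (volume.prod volume)
        (Set.Ioc 0 t ×ˢ Metric.closedBall (0 : EuclideanSpace ℝ (Fin d)) (1 / 2)) := by
        refine measure_mono ?_
        rintro ⟨s, y⟩ ⟨hs, -, hy, -⟩
        exact ⟨hs, by simpa using hy⟩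
    _ = _ := by simp [Measure.prod_prod]

lemma rpow_le_volume_heatSection {d : ℕ} (hd : 1 ≤ d) {κ t r z A : ℝ} (hκ : 0 < κ) (hr : 0 < r)
    (hA : 0 < A) (hAz : A ≤ z / r) (hAt : A ^ (2 / (d : ℝ)) / (2 * π * κ) ≤ 2 * t)
    (hAd : A ^ (2 / (d : ℝ)) / (2 * π * κ) ≤ 2 / (κ * d)) :
    ENNReal.ofReal (1 / 4 * (κ * d / 8) ^ ((d : ℝ) / 2) / (2 * π * κ) ^ (1 + (d : ℝ) / 2) *
        (volume (Metric.ball (0 : EuclideanSpace ℝ (Fin d)) 1)).toReal * A ^ (1 + 2 / (d : ℝ))) ≤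
      (volume.prod volume) (heatSection d κ t r z) := by
  set σ := A ^ (2 / (d : ℝ)) / (2 * π * κ) with hσ
  have hσ₀ : 0 < σ := by positivity
  have hd' : (0 : ℝ) < d := by exact_mod_cast hd
  rw [← volume_prod_closedBall (by norm_num) (by positivity) hκ hd hA
    (I := Set.Icc (σ / 4) (σ / 2)) (by rw [Real.volume_Icc, ← hσ]; ring_nf), ← hσ]
  refine measure_mono ?_
  rintro ⟨s, y⟩ ⟨⟨hs₁, hs₂⟩, hy⟩
  have hs₁ : σ / 4 ≤ s := hs₁
  have hs₂ : s ≤ σ / 2 := hs₂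
  have hy : ‖y‖ ^ 2 ≤ κ * d / 8 * σ :=
    (Real.le_sqrt (norm_nonneg y) (by positivity)).1 (by simpa using hy)
  have hz : 0 < z := (div_pos_iff_of_pos_right hr).1 (hA.trans_le hAz)
  have h := one_lt_heatKernel_mul_rpow hd hκ hσ₀ hs₁ hs₂ hy
  rw [hσ, rpow_two_div_scale hκ hd hA] at h
  refine ⟨⟨by linarith, by linarith⟩, hz, ?_, ?_⟩
  · have hAd' : κ * d / 8 * σ ≤ (1 / 2) ^ 2 := by
      rw [le_div_iff₀ (by positivity)] at hAd
      linarith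
    exact (sq_le_sq₀ (norm_nonneg y) (by norm_num)).1 (hy.trans hAd')
  · have hg : 0 ≤ heatKernel d κ s y := by
      have : 0 < s := by linarith
      unfold heatKernel
      positivity
    have h' := h.trans_le (mul_le_mul_of_nonneg_left hAz hg)
    rwa [← mul_div_assoc, one_lt_div hr] at h'

lemma ofReal_mul_Mgamma {lam : Measure ℝ} {c r γ x : ℝ} (hc : 0 ≤ c) (hr : 0 < r) :
    ENNReal.ofReal (c * r ^ (-γ)) * Mgamma lam γ x =
      ∫⁻ z in Set.Ioc 0 x, ENNReal.ofReal (c * (z / r) ^ γ) ∂lam := by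
  rw [Mgamma, ← lintegral_const_mul _ (by fun_prop)]
  refine setLIntegral_congr_fun measurableSet_Ioc fun z hz => ?_
  have hz₀ : 0 < z := hz.1
  rw [← ENNReal.ofReal_mul (by positivity), Real.div_rpow hz₀.le hr.le, Real.rpow_neg hr.le]
  congr 1
  ring

/-- Equation (5.9): there are constants `c₁, c₂, C₁, C₂ > 0` depending only on `d`,
`t`, `κ`, such that for every Lévy measure `λ` and every `r > 1`,
`c₁ r^{-1-2/d} M_{1+2/d}(c₂ r) + c₁ λ̄(c₂ r) ≤ η̄₀(r)
  ≤ C₁ r^{-1-2/d} M_{1+2/d}(C₂ r) + C₁ λ̄(C₂ r)` in `[0,∞]`. -/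
theorem stmt_19 (d : ℕ) (hd : 1 ≤ d) (κ t : ℝ) (hκ : 0 < κ) (ht : 0 < t) :
    ∃ c₁ > (0 : ℝ), ∃ c₂ > (0 : ℝ), ∃ C₁ > (0 : ℝ), ∃ C₂ > (0 : ℝ),
      ∀ lam : Measure ℝ, IsLevyMeasure lam → ∀ r > (1 : ℝ),
        ENNReal.ofReal (c₁ * r ^ (-1 - 2 / (d : ℝ))) *
              Mgamma lam (1 + 2 / (d : ℝ)) (c₂ * r) +
            ENNReal.ofReal c₁ * lam (Set.Ioi (c₂ * r)) ≤
          etaBar0 d κ t lam r ∧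
        etaBar0 d κ t lam r ≤
          ENNReal.ofReal (C₁ * r ^ (-1 - 2 / (d : ℝ))) *
              Mgamma lam (1 + 2 / (d : ℝ)) (C₂ * r) +
            ENNReal.ofReal C₁ * lam (Set.Ioi (C₂ * r)) := by
  have hd' : (0 : ℝ) < d := by exact_mod_cast hd
  have hγ : -1 - 2 / (d : ℝ) = -(1 + 2 / (d : ℝ)) := by ring
  have hω : 0 < (volume (Metric.ball (0 : EuclideanSpace ℝ (Fin d)) 1)).toReal :=
    ENNReal.toReal_pos (Metric.measure_ball_pos _ _ one_pos).ne' measure_ball_lt_top.ne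
  set k₁ := 1 / 4 * (κ * d / 8) ^ ((d : ℝ) / 2) / (2 * π * κ) ^ (1 + (d : ℝ) / 2) *
    (volume (Metric.ball (0 : EuclideanSpace ℝ (Fin d)) 1)).toReal
  set k₂ := 1 * (κ * d) ^ ((d : ℝ) / 2) / (2 * π * κ) ^ (1 + (d : ℝ) / 2) *
    (volume (Metric.ball (0 : EuclideanSpace ℝ (Fin d)) 1)).toReal
  set B := ENNReal.ofReal t * volume (Metric.closedBall (0 : EuclideanSpace ℝ (Fin d)) (1 / 2))
  have hB_top : B ≠ ⊤ := ENNReal.mul_ne_top ENNReal.ofReal_ne_top measure_closedBall_lt_top.ne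
  have hk₁_pos : 0 < k₁ := by positivity
  have hk₂_pos : 0 < k₂ := by positivity
  set c₂ := (2 * π * κ * min (2 * t) (2 / (κ * d))) ^ ((d : ℝ) / 2) with hc₂
  have hm : 0 < min (2 * t) (2 / (κ * d)) := by positivity
  have hc₂_pos : 0 < c₂ := by positivity
  have hscale : ∀ A, 0 < A → A ≤ c₂ →
      A ^ (2 / (d : ℝ)) / (2 * π * κ) ≤ min (2 * t) (2 / (κ * d)) := by
    intro A hA hAc
    rw [div_le_iff₀' (by positivity)]
    refine (Real.rpow_le_rpow hA.le hAc (by positivity)).trans_eq ?_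
    rw [hc₂, ← Real.rpow_mul (by positivity), show (d : ℝ) / 2 * (2 / d) = 1 by field_simp,
      Real.rpow_one]
  refine ⟨min k₁ (k₁ * c₂ ^ (1 + 2 / (d : ℝ))), by positivity, c₂, hc₂_pos,
    max k₂ B.toReal, lt_max_of_lt_left hk₂_pos, 1, one_pos, fun lam hlam r hr => ?_⟩
  have hr₀ : 0 < r := zero_lt_one.trans hr
  have hsplit : ∀ x, 0 < x → etaBar0 d κ t lam r =
      (∫⁻ z in Set.Ioc 0 x, (volume.prod volume) (heatSection d κ t r z) ∂lam) +
        ∫⁻ z in Set.Ioi x, (volume.prod volume) (heatSection d κ t r z) ∂lam := by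
    intro x hx
    rw [etaBar0_eq_lintegral hlam, ← Set.Ioc_union_Ioi_eq_Ioi hx.le,
      lintegral_union measurableSet_Ioi (Set.Ioc_disjoint_Ioi le_rfl)]
  rw [hγ, ofReal_mul_Mgamma (by positivity) hr₀, ofReal_mul_Mgamma (by positivity) hr₀]
  constructor
  · rw [hsplit (c₂ * r) (by positivity), ← setLIntegral_const]
    refine add_le_add (setLIntegral_mono' measurableSet_Ioc fun z hz => ?_)
      (setLIntegral_mono' measurableSet_Ioi fun z hz => ?_)
    · have hA : 0 < z / r := div_pos hz.1 hr₀
      have hs := hscale _ hA ((div_le_iff₀ hr₀).2 hz.2)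
      refine le_trans (ENNReal.ofReal_le_ofReal ?_) (rpow_le_volume_heatSection hd hκ hr₀ hA le_rfl
        (hs.trans (min_le_left _ _)) (hs.trans (min_le_right _ _)))
      exact mul_le_mul_of_nonneg_right (min_le_left _ _) (by positivity)
    · have hs := hscale _ hc₂_pos le_rfl
      exact (ENNReal.ofReal_le_ofReal (min_le_right _ _)).trans
        (rpow_le_volume_heatSection hd hκ hr₀ hc₂_pos ((le_div_iff₀ hr₀).2 (le_of_lt hz))
          (hs.trans (min_le_left _ _)) (hs.trans (min_le_right _ _)))
  · rw [hsplit (1 * r) (by positivity), ← setLIntegral_const]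
    refine add_le_add (setLIntegral_mono' measurableSet_Ioc fun z hz => ?_)
      (setLIntegral_mono' measurableSet_Ioi fun z hz => ?_)
    · have hA : 0 < z / r := div_pos hz.1 hr₀
      refine (volume_heatSection_le_rpow hd hκ hr₀ hz.1).trans (ENNReal.ofReal_le_ofReal ?_)
      exact mul_le_mul_of_nonneg_right (le_max_left _ _) (by positivity)
    · exact (volume_heatSection_le.trans_eq (ENNReal.ofReal_toReal hB_top).symm).trans
        (ENNReal.ofReal_le_ofReal (le_max_right _ _))
end
end
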